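/- For all m₁ ∈ ℤ and m̲ ∈ ℤ^{n−1}, one has Υ₀Υ_θ(e_θ⊗t₁^{m₁+2}t^{m̲}) = e_θ⊗t₁^{m₁}t^{m̲} in the toroidal Lie algebra 𝒯. -/

import Mathlib

open scoped BigOperators

/-- The relations submodule defining the space of Kähler differentials modulo exact forms:
`𝒵` is spanned by symbols `t^𝐦 Kᵢ` subject exactly to `∑ᵢ mᵢ t^𝐦 Kᵢ = 0`. -/
noncomputable def ZRel (n : ℕ) : Submodule ℂ ((Fin n → ℤ) →₀ (Fin n → ℂ)) :=
  Submodule.span ℂ {z | ∃ m : Fin n → ℤ, z = Finsupp.single m (fun i => (m i : ℂ))}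

/-- Concrete model for the centre `𝒵` of the toroidal Lie algebra. -/
abbrev ZModel (n : ℕ) := ((Fin n → ℤ) →₀ (Fin n → ℂ)) ⧸ ZRel n

/-- A bundle of data presenting the toroidal Lie algebra
`𝒯 = (𝔤 ⊗ ℂ[t₁^{±1},…,tₙ^{±1}]) ⊕ 𝒵 ⊕ D` attached to a finite dimensional simple complex
Lie algebra `𝔤` of rank `l`, together with the usual root-vector data of `𝔤`.
`tg m x` is `x ⊗ t^𝐦`, `tK m i` is `t^𝐦 Kᵢ` and `d i` is the derivation `dᵢ` (indices start
at `0`, so `d 0` is the derivation `d₁` of the paper).  The projections `πg, πZ, πd` encode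
that `𝒯` is presented by *exactly* the stated relations, i.e. that
`𝒯 = (𝔤⊗Aₙ) ⊕ 𝒵 ⊕ D` is a direct sum with each summand free on the given generators. -/
structure ToroidalData (n l : ℕ) where
  g : Type
  [instLieRing_g : LieRing g]
  [instLieAlgebra_g : LieAlgebra ℂ g]
  [instFD : FiniteDimensional ℂ g]
  isSimple : LieAlgebra.IsSimple ℂ g
  cartan : LieSubalgebra ℂ g
  Bf : LinearMap.BilinForm ℂ g
  Bf_symm : ∀ x y, Bf x y = Bf y x
  Bf_invariant : ∀ x y z, Bf ⁅x, y⁆ z = Bf x ⁅y, z⁆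
  /-- index type for the set of positive roots `R_fin⁺` of `𝔤` -/
  PosRoot : Type
  /-- the root vector `x_α`, for `α ∈ R_fin⁺` -/
  xp : PosRoot → g
  /-- the root vector `x_{-α}`, for `α ∈ R_fin⁺` -/
  xm : PosRoot → g
  /-- the coroot `h_α = [x_α, x_{-α}]` -/
  hc : PosRoot → g
  hc_mem_cartan : ∀ a, hc a ∈ cartan
  sl2_h : ∀ a, ⁅xp a, xm a⁆ = hc a
  sl2_e : ∀ a, ⁅hc a, xp a⁆ = (2 : ℂ) • xp a
  sl2_f : ∀ a, ⁅hc a, xm a⁆ = (-2 : ℂ) • xm a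
  /-- `(x_α, x_{-α}) = 2/(α,α)`, expressed via `(h_α,h_α) = 4/(α,α)` -/
  pair_xp_xm : ∀ a, Bf (xp a) (xm a) = Bf (hc a) (hc a) / 2
  /-- the simple roots `α₁, …, α_l` among the positive roots -/
  simpleRoot : Fin l → PosRoot
  /-- the highest root `θ` -/
  theta : PosRoot
  /-- normalisation `(θ,θ) = 2`, i.e. `(h_θ, h_θ) = 2` -/
  theta_norm : Bf (hc theta) (hc theta) = 2
  /-- the underlying space of the toroidal Lie algebra `𝒯` -/
  T : Type
  [instLieRing_T : LieRing T]
  [instLieAlgebra_T : LieAlgebra ℂ T]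
  /-- `tg m x = x ⊗ t^𝐦` -/
  tg : (Fin n → ℤ) → g →ₗ[ℂ] T
  /-- `tK m i = t^𝐦 Kᵢ` -/
  tK : (Fin n → ℤ) → Fin n → T
  /-- the derivations `d₁, …, dₙ` -/
  d : Fin n → T
  span_top : Submodule.span ℂ
      ({z | ∃ m x, z = tg m x} ∪ {z | ∃ m i, z = tK m i} ∪ Set.range d) = (⊤ : Submodule ℂ T)
  K_rel : ∀ m : Fin n → ℤ, ∑ i, (m i : ℂ) • tK m i = 0
  br_gg : ∀ p q x y, ⁅tg p x, tg q y⁆ =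
      tg (p + q) ⁅x, y⁆ + Bf x y • ∑ i, (p i : ℂ) • tK (p + q) i
  br_gK : ∀ p x m i, ⁅tg p x, tK m i⁆ = 0
  br_KK : ∀ p i q j, ⁅tK p i, tK q j⁆ = 0
  br_dg : ∀ i p x, ⁅d i, tg p x⁆ = (p i : ℂ) • tg p x
  br_dK : ∀ i p j, ⁅d i, tK p j⁆ = (p i : ℂ) • tK p j
  br_dd : ∀ i j, ⁅d i, d j⁆ = 0
  πg : T →ₗ[ℂ] ((Fin n → ℤ) →₀ g)
  πZ : T →ₗ[ℂ] ZModel n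
  πd : T →ₗ[ℂ] (Fin n → ℂ)
  πg_tg : ∀ m x, πg (tg m x) = Finsupp.single m x
  πg_tK : ∀ m i, πg (tK m i) = 0
  πg_d : ∀ i, πg (d i) = 0
  πZ_tg : ∀ m x, πZ (tg m x) = 0
  πZ_tK : ∀ m i, πZ (tK m i) = Submodule.Quotient.mk (Finsupp.single m (Pi.single i 1))
  πZ_d : ∀ i, πZ (d i) = 0
  πd_tg : ∀ m x, πd (tg m x) = 0
  πd_tK : ∀ m i, πd (tK m i) = 0
  πd_d : ∀ i, πd (d i) = Pi.single i 1
  joint_inj : ∀ z : T, πg z = 0 → πZ z = 0 → πd z = 0 → z = 0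

attribute [instance] ToroidalData.instLieRing_g ToroidalData.instLieAlgebra_g
  ToroidalData.instFD ToroidalData.instLieRing_T ToroidalData.instLieAlgebra_T

/-- `f` is the exponential `exp(ad v)` of the (locally nilpotent) adjoint action of `v`:
on every vector the defining series stabilises to a finite sum. -/
def IsExpAd {L : Type} [LieRing L] [LieAlgebra ℂ L] (v : L) (f : Module.End ℂ L) : Prop :=
  ∀ w : L, ∃ N : ℕ, ∀ M : ℕ, N ≤ M →
    f w = ∑ k ∈ Finset.range (M + 1),
      ((k.factorial : ℂ))⁻¹ • (((LieAlgebra.ad ℂ L v) ^ k) w)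

/-- If `(ad v)³ x = 0`, the exponential series of `ad v` at `x` has only three terms. -/
theorem IsExpAd.apply_eq {L : Type} [LieRing L] [LieAlgebra ℂ L] {v : L} {f : Module.End ℂ L}
    (hf : IsExpAd v f) {x : L} (hx : ⁅v, ⁅v, ⁅v, x⁆⁆⁆ = 0) :
    f x = x + ⁅v, x⁆ + (2 : ℂ)⁻¹ • ⁅v, ⁅v, x⁆⁆ := by
  obtain ⟨N, hN⟩ := hf x
  have hpow (k : ℕ) : ((LieAlgebra.ad ℂ L v) ^ (k + 3)) x = 0 := by
    have h3 : ((LieAlgebra.ad ℂ L v) ^ 3) x = 0 := by simpa [pow_succ] using hx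
    rw [pow_add, Module.End.mul_apply, h3, map_zero]
  rw [hN (N + 2) (by omega), show N + 2 + 1 = 3 + N by omega, Finset.sum_range_add,
    Finset.sum_eq_zero (s := Finset.range N) fun k _ ↦ by rw [add_comm 3 k, hpow, smul_zero]]
  simp [Finset.sum_range_succ, pow_succ]

theorem IsExpAd.apply_eq_self {L : Type} [LieRing L] [LieAlgebra ℂ L] {v : L}
    {f : Module.End ℂ L} (hf : IsExpAd v f) {x : L} (hx : ⁅v, x⁆ = 0) : f x = x := by
  simpa [hx] using hf.apply_eq (x := x) (by simp [hx])

/-- The reflection `exp(ad x⊗t^k) exp(ad (-y⊗t^{-k})) exp(ad x⊗t^k)` attached to a normalised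
`𝔰𝔩₂`-triple sends `x⊗t^{q+2k}` to `-y⊗t^q`. -/
theorem ToroidalData.reflection_apply {n l : ℕ} (𝕋 : ToroidalData n l) {h x y : 𝕋.g}
    (ht : IsSl2Triple h x y) (hxy : 𝕋.Bf x y = 1) (k q : Fin n → ℤ) {E F : Module.End ℂ 𝕋.T}
    (hE : IsExpAd (𝕋.tg k x) E) (hF : IsExpAd (-(𝕋.tg (-k) y)) F) :
    E (F (E (𝕋.tg (q + k + k) x))) = -𝕋.tg q y := by
  have hhx : ⁅h, x⁆ = (2 : ℂ) • x := by rw [ht.lie_h_e_nsmul, two_smul, two_smul]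
  have hhy : ⁅h, y⁆ = -((2 : ℂ) • y) := by rw [ht.lie_h_f_nsmul, two_smul, two_smul]
  have hxh : ⁅x, h⁆ = -((2 : ℂ) • x) := by rw [← lie_skew, hhx]
  have hyh : ⁅y, h⁆ = (2 : ℂ) • y := by rw [← lie_skew, hhy, neg_neg]
  have hyx' : ⁅y, x⁆ = -h := by rw [← lie_skew, ht.lie_e_f]
  have hBxx : 𝕋.Bf x x = 0 := by simpa [hhx] using 𝕋.Bf_invariant h x x
  have hByy : 𝕋.Bf y y = 0 := by simpa [hhy] using 𝕋.Bf_invariant h y y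
  have hBxh : 𝕋.Bf x h = 0 := by simpa [ht.lie_e_f] using (𝕋.Bf_invariant x x y).symm
  have hByh : 𝕋.Bf y h = 0 := by simpa [hyx'] using 𝕋.Bf_invariant y y x
  have hyx : 𝕋.Bf y x = 1 := by rw [𝕋.Bf_symm, hxy]
  set Z : 𝕋.T := ∑ i, (k i : ℂ) • 𝕋.tK (q + k) i with hZ
  have bZ (p : Fin n → ℤ) (u : 𝕋.g) : ⁅𝕋.tg p u, Z⁆ = 0 := by simp [hZ, lie_sum, 𝕋.br_gK]
  have bxx (p : Fin n → ℤ) : ⁅𝕋.tg k x, 𝕋.tg p x⁆ = 0 := by simp [𝕋.br_gg, hBxx]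
  have byy (p : Fin n → ℤ) : ⁅𝕋.tg (-k) y, 𝕋.tg p y⁆ = 0 := by simp [𝕋.br_gg, hByy]
  have bxh : ⁅𝕋.tg k x, 𝕋.tg (q + k) h⁆ = -((2 : ℂ) • 𝕋.tg (q + k + k) x) := by
    rw [𝕋.br_gg, hxh, hBxh, add_comm k]
    simp
  have bxy : ⁅𝕋.tg k x, 𝕋.tg q y⁆ = 𝕋.tg (q + k) h + Z := by
    rw [𝕋.br_gg, ht.lie_e_f, hxy, add_comm k, one_smul]
  have byx : ⁅𝕋.tg (-k) y, 𝕋.tg (q + k + k) x⁆ = -(𝕋.tg (q + k) h + Z) := by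
    rw [𝕋.br_gg, hyx', hyx, show -k + (q + k + k) = q + k by abel]
    simp [hZ, add_comm]
  have byh : ⁅𝕋.tg (-k) y, 𝕋.tg (q + k) h⁆ = (2 : ℂ) • 𝕋.tg q y := by
    rw [𝕋.br_gg, hyh, hByh, show -k + (q + k) = q by abel]
    simp
  have Ex : E (𝕋.tg (q + k + k) x) = 𝕋.tg (q + k + k) x := hE.apply_eq_self (bxx _)
  have EZ : E Z = Z := hE.apply_eq_self (bZ _ _)
  have Eh : E (𝕋.tg (q + k) h) = 𝕋.tg (q + k) h - (2 : ℂ) • 𝕋.tg (q + k + k) x := by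
    rw [hE.apply_eq] <;> simp [bxh, bxx, sub_eq_add_neg]
  have Ey : E (𝕋.tg q y) = 𝕋.tg q y + (𝕋.tg (q + k) h + Z) - 𝕋.tg (q + k + k) x := by
    rw [hE.apply_eq] <;> simp [bxy, bxh, bxx, bZ, sub_eq_add_neg]
  have Fx : F (𝕋.tg (q + k + k) x) =
      𝕋.tg (q + k + k) x + (𝕋.tg (q + k) h + Z) - 𝕋.tg q y := by
    rw [hF.apply_eq] <;> simp [byx, byh, byy, bZ, sub_eq_add_neg]
  rw [Ex, Fx, map_sub, map_add, map_add, Ex, Eh, EZ, Ey]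
  module

/-- With `Υ₀ = exp(ad e₀) ∘ exp(ad(-f₀)) ∘ exp(ad e₀)` and
`Υ_θ = exp(ad e_θ) ∘ exp(ad(-f_θ)) ∘ exp(ad e_θ)` (where `e₀ = f_θ⊗t₁`,
`f₀ = e_θ⊗t₁^{-1}`), one has
`Υ₀Υ_θ(e_θ ⊗ t₁^{m₁+2} t^{m̲}) = e_θ ⊗ t₁^{m₁} t^{m̲}` for all `m₁ ∈ ℤ`, `m̲ ∈ ℤ^{n-1}`. -/
theorem statement9 {n l : ℕ} [NeZero n] (hn : 2 ≤ n) (𝕋 : ToroidalData n l)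
    (E0 F0 Eth Fth : Module.End ℂ 𝕋.T)
    (hE0 : IsExpAd (𝕋.tg (Pi.single 0 1) (𝕋.xm 𝕋.theta)) E0)
    (hF0 : IsExpAd (-(𝕋.tg (Pi.single 0 (-1)) (𝕋.xp 𝕋.theta))) F0)
    (hEth : IsExpAd (𝕋.tg 0 (𝕋.xp 𝕋.theta)) Eth)
    (hFth : IsExpAd (-(𝕋.tg 0 (𝕋.xm 𝕋.theta))) Fth)
    (m : Fin n → ℤ) :
    E0 (F0 (E0 (Eth (Fth (Eth
        (𝕋.tg (m + Pi.single 0 2) (𝕋.xp 𝕋.theta))))))) =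
      𝕋.tg m (𝕋.xp 𝕋.theta) := by
  set θ := 𝕋.theta
  have hne : 𝕋.hc θ ≠ 0 := fun h0 ↦ by simpa [θ, h0] using 𝕋.theta_norm
  have ht : IsSl2Triple (𝕋.hc θ) (𝕋.xp θ) (𝕋.xm θ) :=
    { h_ne_zero := hne
      lie_e_f := 𝕋.sl2_h θ
      lie_h_e_nsmul := by rw [𝕋.sl2_e, two_smul, two_smul]
      lie_h_f_nsmul := by rw [𝕋.sl2_f, neg_smul, two_smul, two_smul] }
  have hB : 𝕋.Bf (𝕋.xp θ) (𝕋.xm θ) = 1 := by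
    rw [𝕋.pair_xp_xm, 𝕋.theta_norm, div_self two_ne_zero]
  have hm : m + Pi.single 0 2 = m + Pi.single 0 1 + Pi.single 0 1 := by
    rw [add_assoc, ← Pi.single_add, one_add_one_eq_two]
  have hθ := 𝕋.reflection_apply ht hB 0 (m + Pi.single 0 2) hEth (by rwa [neg_zero])
  rw [add_zero, add_zero] at hθ
  rw [hθ, map_neg, map_neg, map_neg, hm, 𝕋.reflection_apply ht.symm
    (by rw [𝕋.Bf_symm, hB]) _ m hE0 (by rwa [← Pi.single_neg]), neg_neg]
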